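/- Let (Z,ρ₀) be an antipodal space, ρ₁ ∈ M(Z), τ₀ ∈ C(Z); set ρ := P_∞(τ₀, ρ₁) and τ := log(dρ/dρ₁). Then for all ξ ∈ Z: τ(ξ) ≥ τ₀(ξ) − (1/2)·D_{ρ₁}(τ₀)(ξ); and τ(ξ) ≤ τ₀(ξ) − D_{ρ₁}(τ₀)(ξ) + (1/2)·D_{ρ₁}(τ₀)(η) for every η ∈ Z at which the function ζ ↦ E_{ρ₁}(τ₀)(ξ,ζ) attains its maximum over Z. -/

import Mathlib

open Filter Topology
open scoped Classical

variable {Z : Type*}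

/-- `Z` has at least four points. -/
def HasFourPoints (Z : Type*) : Prop :=
  ∃ a b c d : Z, a ≠ b ∧ a ≠ c ∧ a ≠ d ∧ b ≠ c ∧ b ≠ d ∧ c ≠ d

/-- A separating function on `Z`: continuous, symmetric, and positive. -/
structure IsSeparating [TopologicalSpace Z] (ρ : Z → Z → ℝ) : Prop where
  continuous : Continuous fun p : Z × Z => ρ p.1 p.2
  symm : ∀ ξ η, ρ ξ η = ρ η ξ
  nonneg : ∀ ξ η, 0 ≤ ρ ξ η
  eq_zero_iff : ∀ ξ η, ρ ξ η = 0 ↔ ξ = η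

/-- The cross-ratio of a quadruple of points with respect to `ρ`. -/
noncomputable def crossRatio (ρ : Z → Z → ℝ) (ξ ξ' η η' : Z) : ℝ :=
  ρ ξ η * ρ ξ' η' / (ρ ξ η' * ρ ξ' η)

/-- Two functions are Moebius equivalent if their cross-ratios agree on all quadruples
of pairwise distinct points. -/
def MoebiusEquiv (ρ₁ ρ₂ : Z → Z → ℝ) : Prop :=
  ∀ ξ ξ' η η' : Z, ξ ≠ ξ' → ξ ≠ η → ξ ≠ η' → ξ' ≠ η → ξ' ≠ η' → η ≠ η' →
    crossRatio ρ₁ ξ ξ' η η' = crossRatio ρ₂ ξ ξ' η η'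

/-- An antipodal function on `Z`: a separating function with values in `[0,1]` such that
every point has an antipode. -/
structure IsAntipodal [TopologicalSpace Z] (ρ : Z → Z → ℝ) : Prop where
  toIsSeparating : IsSeparating ρ
  le_one : ∀ ξ η, ρ ξ η ≤ 1
  antipode : ∀ ξ, ∃ η, ρ ξ η = 1

/-- The Moebius space `M(Z, ρ₀)`: antipodal functions Moebius equivalent to `ρ₀`. -/
def MoebiusSpace [TopologicalSpace Z] (ρ₀ : Z → Z → ℝ) : Set (Z → Z → ℝ) :=
  {ρ | IsAntipodal ρ ∧ MoebiusEquiv ρ₀ ρ}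

/-- The derivative `dρ₂/dρ₁`: the (unique, when it exists) positive continuous function
satisfying the geometric mean value theorem
`ρ₂(ξ,η)² = f(ξ) f(η) ρ₁(ξ,η)²`. -/
noncomputable def mDeriv [TopologicalSpace Z] (ρ₁ ρ₂ : Z → Z → ℝ) : Z → ℝ :=
  if h : ∃ f : Z → ℝ, Continuous f ∧ (∀ ξ, 0 < f ξ) ∧
      ∀ ξ η, ρ₂ ξ η ^ 2 = f ξ * f η * ρ₁ ξ η ^ 2
  then h.choose else fun _ => 1

/-- The metric `d_M(ρ₁, ρ₂) = ‖log (dρ₂/dρ₁)‖_∞` on the Moebius space. -/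
noncomputable def dM [TopologicalSpace Z] (ρ₁ ρ₂ : Z → Z → ℝ) : ℝ :=
  ⨆ ξ : Z, |Real.log (mDeriv ρ₁ ρ₂ ξ)|

/-- The discrepancy function `D_{ρ₁}(τ)(ξ) = max_{η ≠ ξ} (τ(ξ) + τ(η) + log ρ₁(ξ,η)²)`. -/
noncomputable def discrepancy [TopologicalSpace Z] (ρ₁ : Z → Z → ℝ) (τ : C(Z, ℝ))
    (ξ : Z) : ℝ :=
  ⨆ η : {η : Z // η ≠ ξ}, (τ ξ + τ η.1 + Real.log (ρ₁ ξ η.1 ^ 2))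

/-- `E_{ρ₁}(τ)(ξ,η) = e^{τ(ξ)/2} e^{τ(η)/2} ρ₁(ξ,η)`. -/
noncomputable def eMap [TopologicalSpace Z] (ρ₁ : Z → Z → ℝ) (τ : C(Z, ℝ)) :
    Z → Z → ℝ :=
  fun ξ η => Real.exp (τ ξ / 2) * Real.exp (τ η / 2) * ρ₁ ξ η

/-- A solution of the `ρ₁`-antipodal flow `dτ_t/dt = -D_{ρ₁}(τ_t)` on `[0, ∞)`. -/
def IsAntipodalFlowSol [TopologicalSpace Z] [CompactSpace Z]
    (ρ₁ : Z → Z → ℝ) (τ : ℝ → C(Z, ℝ)) : Prop :=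
  ∀ t ∈ Set.Ici (0 : ℝ), ∃ τ' : C(Z, ℝ),
    (∀ ξ, τ' ξ = -discrepancy ρ₁ (τ t) ξ) ∧
    HasDerivWithinAt τ τ' (Set.Ici (0 : ℝ)) t

/-- The antipodalization map `P_∞(τ₀, ρ₁) = E_{ρ₁}(τ_∞)`, where `τ_∞` is the limit as
`t → ∞` of the solution of the `ρ₁`-antipodal flow starting at `τ₀`. -/
noncomputable def antipodalization [TopologicalSpace Z] [CompactSpace Z]
    (ρ₁ : Z → Z → ℝ) (τ₀ : C(Z, ℝ)) : Z → Z → ℝ :=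
  if h : ∃ p : (ℝ → C(Z, ℝ)) × C(Z, ℝ), p.1 0 = τ₀ ∧ IsAntipodalFlowSol ρ₁ p.1 ∧
      Filter.Tendsto p.1 Filter.atTop (𝓝 p.2)
  then eMap ρ₁ h.choose.2 else ρ₁


section GlobalExistence

variable {E : Type*} [NormedAddCommGroup E] [NormedSpace ℝ E]

/-- Solutions of an autonomous ODE on adjacent closed intervals glue to a solution on their
union. -/
theorem IsIntegralCurveOn.glue_Icc {f : E → E} {γ δ : ℝ → E} {a b c : ℝ} (hab : a ≤ b)
    (hbc : b ≤ c) (hγ : IsIntegralCurveOn γ (fun _ => f) (Set.Icc a b))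
    (hδ : IsIntegralCurveOn δ (fun _ => f) (Set.Icc b c)) (h : γ b = δ b) :
    IsIntegralCurveOn (fun t => if t ≤ b then γ t else δ t) (fun _ => f) (Set.Icc a c) := by
  set g : ℝ → E := fun t => if t ≤ b then γ t else δ t with hg
  have hgγ : ∀ t ∈ Set.Icc a b, g t = γ t := fun t ht => if_pos ht.2
  have hgδ : ∀ t ∈ Set.Icc b c, g t = δ t := by
    intro t ht
    by_cases htb : t ≤ b
    · obtain rfl := le_antisymm htb ht.1
      rw [hgγ t ⟨hab, le_rfl⟩, h]
    · exact if_neg htb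
  have hl : ∀ t, HasDerivWithinAt g (f (g t)) (Set.Icc a b) t := by
    intro t
    by_cases ht : t ∈ Set.Icc a b
    · rw [hgγ t ht]
      exact (hγ t ht).congr hgγ (hgγ t ht)
    · exact HasFDerivWithinAt.of_notMem_closure (by rwa [isClosed_Icc.closure_eq])
  have hr : ∀ t, HasDerivWithinAt g (f (g t)) (Set.Icc b c) t := by
    intro t
    by_cases ht : t ∈ Set.Icc b c
    · rw [hgδ t ht]
      exact (hδ t ht).congr hgδ (hgδ t ht)
    · exact HasFDerivWithinAt.of_notMem_closure (by rwa [isClosed_Icc.closure_eq])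
  intro t _
  rw [← Set.Icc_union_Icc_eq_Icc hab hbc]
  exact (hl t).union (hr t)

variable [CompleteSpace E]

/-- For a globally Lipschitz vector field the Picard-Lindelöf existence time is uniform. -/
theorem LipschitzWith.exists_isIntegralCurveOn_Icc_add {K : NNReal} {f : E → E}
    (hf : LipschitzWith K f) (x : E) (b : ℝ) :
    ∃ γ : ℝ → E, γ b = x ∧
      IsIntegralCurveOn γ (fun _ => f) (Set.Icc b (b + 1 / (K + 1))) := by
  have hε : (0 : ℝ) ≤ 1 / (K + 1) := by positivity
  have hP : IsPicardLindelof (fun _ => f) (tmin := b) (tmax := b + 1 / (K + 1))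
      ⟨b, le_rfl, by linarith⟩ x ‖f x‖₊ 0 ((K + 1) * ‖f x‖₊) K := by
    refine IsPicardLindelof.of_time_independent ?_ hf.lipschitzOnWith ?_
    · intro y hy
      have h1 := hf.norm_sub_le y x
      have h2 : ‖y - x‖ ≤ ‖f x‖ := by simpa [dist_eq_norm] using hy
      have h3 : (K : ℝ) * ‖y - x‖ ≤ K * ‖f x‖ := by gcongr
      have h4 := norm_sub_norm_le (f y) (f x)
      push_cast
      linarith
    · have hK : (0 : ℝ) < K + 1 := by positivity
      rw [max_eq_left (by simpa using hε)]
      push_cast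
      simp only [add_sub_cancel_left, sub_zero]
      apply le_of_eq
      field_simp
  exact hP.exists_eq_forall_mem_Icc_hasDerivWithinAt₀

theorem LipschitzWith.exists_isIntegralCurveOn_Icc {K : NNReal} {f : E → E}
    (hf : LipschitzWith K f) (x : E) (T : ℝ) :
    ∃ γ : ℝ → E, γ 0 = x ∧ IsIntegralCurveOn γ (fun _ => f) (Set.Icc 0 T) := by
  have hε : (0 : ℝ) < 1 / (K + 1) := by positivity
  have key : ∀ n : ℕ, ∃ γ : ℝ → E, γ 0 = x ∧
      IsIntegralCurveOn γ (fun _ => f) (Set.Icc 0 (n * (1 / (K + 1)))) := by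
    intro n
    induction n with
    | zero =>
      obtain ⟨γ, h0, hγ⟩ := hf.exists_isIntegralCurveOn_Icc_add x 0
      exact ⟨γ, h0, hγ.mono (Set.Icc_subset_Icc_right (by simp; positivity))⟩
    | succ n ih =>
      obtain ⟨γ, h0, hγ⟩ := ih
      have hn : (0 : ℝ) ≤ n * (1 / (K + 1)) := by positivity
      obtain ⟨δ, hδ0, hδ⟩ := hf.exists_isIntegralCurveOn_Icc_add
        (γ (n * (1 / (K + 1)))) (n * (1 / (K + 1)))
      refine ⟨fun t => if t ≤ n * (1 / (K + 1)) then γ t else δ t, ?_, ?_⟩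
      · simp only [if_pos hn, h0]
      · have := hγ.glue_Icc hn (by linarith) hδ hδ0.symm
        convert this using 2
        push_cast
        ring
  obtain ⟨n, hn⟩ := exists_nat_ge (T / (1 / (K + 1)))
  obtain ⟨γ, h0, hγ⟩ := key n
  exact ⟨γ, h0, hγ.mono (Set.Icc_subset_Icc_right ((div_le_iff₀ hε).1 hn))⟩

/-- A globally Lipschitz vector field on a Banach space has forward integral curves defined for
all time. -/
theorem LipschitzWith.exists_isIntegralCurveOn_Ici {K : NNReal} {f : E → E}
    (hf : LipschitzWith K f) (x : E) :
    ∃ γ : ℝ → E, γ 0 = x ∧ IsIntegralCurveOn γ (fun _ => f) (Set.Ici 0) := by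
  choose γ h0 hγ using hf.exists_isIntegralCurveOn_Icc x
  have hright : ∀ T, ∀ t ∈ Set.Ico 0 T, HasDerivWithinAt (γ T) (f (γ T t)) (Set.Ici t) t := by
    intro T t ht
    refine ((hγ T t ⟨ht.1, ht.2.le⟩).mono (Set.Icc_subset_Icc_left ht.1)).mono_of_mem_nhdsWithin ?_
    exact Icc_mem_nhdsGE ht.2
  have huniq : ∀ S T, S ≤ T → Set.EqOn (γ S) (γ T) (Set.Icc 0 S) := by
    intro S T hST
    exact ODE_solution_unique (v := fun _ => f) (fun _ => hf) (hγ S).continuousOn (hright S)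
      ((hγ T).continuousOn.mono (Set.Icc_subset_Icc_right hST))
      (fun t ht => hright T t ⟨ht.1, ht.2.trans_le hST⟩) ((h0 S).trans (h0 T).symm)
  refine ⟨fun t => γ t t, h0 0, fun t ht => ?_⟩
  have ht0 : (0 : ℝ) ≤ t := ht
  have heq : ∀ s ∈ Set.Icc 0 (t + 1), γ s s = γ (t + 1) s := fun s hs =>
    huniq s (t + 1) hs.2 ⟨hs.1, le_rfl⟩
  have hmem : t ∈ Set.Icc 0 (t + 1) := ⟨ht0, by linarith⟩
  have hd : HasDerivWithinAt (fun s => γ s s) (f (γ t t)) (Set.Icc 0 (t + 1)) t := by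
    rw [heq t hmem]
    exact (hγ (t + 1) t hmem).congr heq (heq t hmem)
  refine hd.mono_of_mem_nhdsWithin ?_
  rw [← Set.Ici_inter_Iic]
  exact inter_mem_nhdsWithin _ (Iic_mem_nhds (by linarith))

end GlobalExistence

theorem HasFourPoints.exists_ne_ne (h4 : HasFourPoints Z) (ξ : Z) :
    ∃ η ζ : Z, ξ ≠ η ∧ ξ ≠ ζ ∧ η ≠ ζ := by
  obtain ⟨a, b, c, d, hab, hac, -, hbc, -, -⟩ := h4
  by_cases ha : ξ = a
  · subst ha
    exact ⟨b, c, hab, hac, hbc⟩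
  · by_cases hb : ξ = b
    · subst hb
      exact ⟨a, c, ha, hbc, hac⟩
    · exact ⟨a, b, ha, hb, hab⟩

/-- A positive function is determined by its products at pairs of distinct points. -/
theorem HasFourPoints.eq_of_mul_eq (h4 : HasFourPoints Z) {f g : Z → ℝ} (hf : ∀ ξ, 0 < f ξ)
    (hg : ∀ ξ, 0 < g ξ) (h : ∀ ξ η, ξ ≠ η → f ξ * f η = g ξ * g η) : f = g := by
  ext ξ
  obtain ⟨η, ζ, h1, h2, h3⟩ := h4.exists_ne_ne ξ
  have hprod : f η * f ζ ≠ 0 := (mul_pos (hf η) (hf ζ)).ne'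
  have hsq : f ξ ^ 2 = g ξ ^ 2 := by
    apply mul_right_cancel₀ hprod
    calc f ξ ^ 2 * (f η * f ζ) = (f ξ * f η) * (f ξ * f ζ) := by ring
      _ = (g ξ * g η) * (g ξ * g ζ) := by rw [h ξ η h1, h ξ ζ h2]
      _ = g ξ ^ 2 * (g η * g ζ) := by ring
      _ = g ξ ^ 2 * (f η * f ζ) := by rw [h η ζ h3]
  exact (pow_left_inj₀ (hf ξ).le (hg ξ).le two_ne_zero).1 hsq

section Separating

variable [TopologicalSpace Z] {ρ : Z → Z → ℝ}

theorem IsSeparating.pos (h : IsSeparating ρ) {ξ η : Z} (hne : ξ ≠ η) : 0 < ρ ξ η :=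
  lt_of_le_of_ne (h.nonneg ξ η) fun h' => hne ((h.eq_zero_iff ξ η).1 h'.symm)

theorem IsAntipodal.log_sq_nonpos (h : IsAntipodal ρ) (ξ η : Z) : Real.log (ρ ξ η ^ 2) ≤ 0 :=
  Real.log_nonpos (sq_nonneg _) (pow_le_one₀ (h.toIsSeparating.nonneg ξ η) (h.le_one ξ η))

theorem IsAntipodal.exists_ne_eq_one (h : IsAntipodal ρ) (ξ : Z) : ∃ η, η ≠ ξ ∧ ρ ξ η = 1 := by
  obtain ⟨η, hη⟩ := h.antipode ξ
  refine ⟨η, ?_, hη⟩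
  rintro rfl
  rw [(h.toIsSeparating.eq_zero_iff η η).2 rfl] at hη
  exact zero_ne_one hη

theorem IsAntipodal.discrepancy_le (h : IsAntipodal ρ) {τ : C(Z, ℝ)} {ξ : Z} {c : ℝ}
    (hc : ∀ η, η ≠ ξ → τ ξ + τ η + Real.log (ρ ξ η ^ 2) ≤ c) : discrepancy ρ τ ξ ≤ c := by
  obtain ⟨η, hη, -⟩ := h.exists_ne_eq_one ξ
  have : Nonempty {η : Z // η ≠ ξ} := ⟨⟨η, hη⟩⟩
  exact ciSup_le fun ζ => hc ζ.1 ζ.2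

theorem eMap_sq (ρ : Z → Z → ℝ) (σ : C(Z, ℝ)) (ξ η : Z) :
    eMap ρ σ ξ η ^ 2 = Real.exp (σ ξ) * Real.exp (σ η) * ρ ξ η ^ 2 := by
  have h : ∀ x : ℝ, Real.exp x = Real.exp (x / 2) ^ 2 := fun x => by
    rw [← Real.exp_nat_mul]
    push_cast
    ring_nf
  rw [eMap, h (σ ξ), h (σ η)]
  ring

theorem IsSeparating.log_eMap_sq (h : IsSeparating ρ) (σ : C(Z, ℝ)) {ξ η : Z} (hne : η ≠ ξ) :
    Real.log (eMap ρ σ ξ η ^ 2) = σ ξ + σ η + Real.log (ρ ξ η ^ 2) := by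
  have := h.pos hne.symm
  rw [eMap_sq, ← Real.exp_add, Real.log_mul (Real.exp_pos _).ne' (by positivity), Real.log_exp]

theorem HasFourPoints.log_mDeriv_eMap (h4 : HasFourPoints Z) (hρ : IsSeparating ρ) (σ : C(Z, ℝ))
    (ξ : Z) : Real.log (mDeriv ρ (eMap ρ σ) ξ) = σ ξ := by
  have hex : ∃ f : Z → ℝ, Continuous f ∧ (∀ ξ, 0 < f ξ) ∧
      ∀ ξ η, eMap ρ σ ξ η ^ 2 = f ξ * f η * ρ ξ η ^ 2 :=
    ⟨fun ξ => Real.exp (σ ξ), by fun_prop, fun _ => Real.exp_pos _, eMap_sq ρ σ⟩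
  have heq : mDeriv ρ (eMap ρ σ) = fun ξ => Real.exp (σ ξ) := by
    rw [mDeriv, dif_pos hex]
    refine h4.eq_of_mul_eq hex.choose_spec.2.1 (fun _ => Real.exp_pos _) fun ξ η hne => ?_
    have hpos := hρ.pos hne
    apply mul_right_cancel₀ (pow_pos hpos 2).ne'
    rw [← hex.choose_spec.2.2 ξ η, eMap_sq]
  rw [heq, Real.log_exp]

/-- At a point where `eMap ρ τ ξ` is maximal, the supremum defining the discrepancy is attained. -/
theorem IsAntipodal.discrepancy_le_of_forall_eMap_le (h : IsAntipodal ρ) (τ : C(Z, ℝ))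
    {ξ η : Z} (hη : ∀ ζ, eMap ρ τ ξ ζ ≤ eMap ρ τ ξ η) :
    η ≠ ξ ∧ discrepancy ρ τ ξ ≤ τ ξ + τ η + Real.log (ρ ξ η ^ 2) := by
  have hpos : ∀ ζ, ζ ≠ ξ → 0 < eMap ρ τ ξ ζ := by
    intro ζ hζ
    have := h.toIsSeparating.pos hζ.symm
    rw [eMap]
    positivity
  have hne : η ≠ ξ := by
    rintro rfl
    obtain ⟨ζ, hζ, -⟩ := h.exists_ne_eq_one η
    have := (hpos ζ hζ).trans_le (hη ζ)
    rw [eMap, (h.toIsSeparating.eq_zero_iff η η).2 rfl, mul_zero] at this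
    exact this.false
  refine ⟨hne, h.discrepancy_le fun ζ hζ => ?_⟩
  rw [← h.toIsSeparating.log_eMap_sq τ hζ, ← h.toIsSeparating.log_eMap_sq τ hne]
  exact Real.log_le_log (pow_pos (hpos ζ hζ) 2) (pow_le_pow_left₀ (hpos ζ hζ).le (hη ζ) 2)

end Separating

section Discrepancy

variable [TopologicalSpace Z] [CompactSpace Z] {ρ : Z → Z → ℝ}

theorem IsAntipodal.le_discrepancy (h : IsAntipodal ρ) (τ : C(Z, ℝ)) {ξ η : Z} (hne : η ≠ ξ) :
    τ ξ + τ η + Real.log (ρ ξ η ^ 2) ≤ discrepancy ρ τ ξ := by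
  refine le_ciSup (f := fun η : {η : Z // η ≠ ξ} => τ ξ + τ η.1 + Real.log (ρ ξ η.1 ^ 2)) ?_
    ⟨η, hne⟩
  refine ⟨2 * ‖τ‖, ?_⟩
  rintro _ ⟨ζ, rfl⟩
  have h1 := h.log_sq_nonpos ξ ζ
  have h2 := τ.apply_le_norm ξ
  have h3 := τ.apply_le_norm ζ
  dsimp only
  linarith

theorem IsAntipodal.discrepancy_le_norm (h : IsAntipodal ρ) (τ : C(Z, ℝ)) (ξ : Z) :
    discrepancy ρ τ ξ ≤ 2 * ‖τ‖ :=
  h.discrepancy_le fun η _ => by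
    linarith [h.log_sq_nonpos ξ η, τ.apply_le_norm ξ, τ.apply_le_norm η]

theorem IsAntipodal.neg_norm_le_discrepancy (h : IsAntipodal ρ) (τ : C(Z, ℝ)) (ξ : Z) :
    -(2 * ‖τ‖) ≤ discrepancy ρ τ ξ := by
  obtain ⟨η, hη, h1⟩ := h.exists_ne_eq_one ξ
  have := h.le_discrepancy τ hη
  simp only [h1, one_pow, Real.log_one] at this
  linarith [τ.neg_norm_le_apply ξ, τ.neg_norm_le_apply η]

theorem IsAntipodal.discrepancy_le_add (h : IsAntipodal ρ) (τ σ : C(Z, ℝ)) (ξ : Z) :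
    discrepancy ρ τ ξ ≤ discrepancy ρ σ ξ + 2 * ‖τ - σ‖ :=
  h.discrepancy_le fun η hη => by
    have h1 := (τ - σ).apply_le_norm ξ
    have h2 := (τ - σ).apply_le_norm η
    simp only [ContinuousMap.sub_apply] at h1 h2
    linarith [h.le_discrepancy σ hη]

theorem IsAntipodal.continuous_discrepancy (h : IsAntipodal ρ) (τ : C(Z, ℝ)) :
    Continuous (discrepancy ρ τ) := by
  set g : Z → Z → ℝ := fun ξ η => Real.exp (τ ξ + τ η) * ρ ξ η ^ 2 with hg
  have hgc : Continuous fun p : Z × Z => g p.1 p.2 := by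
    have := h.toIsSeparating.continuous
    fun_prop
  have hsup : Continuous fun ξ => sSup (g ξ '' Set.univ) := isCompact_univ.continuous_sSup hgc
  have hbdd : ∀ ξ, BddAbove (g ξ '' Set.univ) := fun ξ =>
    (isCompact_univ.image (hgc.comp (Continuous.prodMk_right ξ))).bddAbove
  have hle : ∀ ξ η, g ξ η ≤ sSup (g ξ '' Set.univ) := fun ξ η =>
    le_csSup (hbdd ξ) ⟨η, Set.mem_univ _, rfl⟩
  have hlog : ∀ ξ η, η ≠ ξ → Real.log (g ξ η) = τ ξ + τ η + Real.log (ρ ξ η ^ 2) := by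
    intro ξ η hη
    have := h.toIsSeparating.pos hη.symm
    rw [hg, Real.log_mul (Real.exp_pos _).ne' (by positivity), Real.log_exp]
  have hgpos : ∀ ξ η, η ≠ ξ → 0 < g ξ η := by
    intro ξ η hη
    have := h.toIsSeparating.pos hη.symm
    positivity
  have hpos : ∀ ξ, 0 < sSup (g ξ '' Set.univ) := by
    intro ξ
    obtain ⟨η, hη, -⟩ := h.exists_ne_eq_one ξ
    exact (hgpos ξ η hη).trans_le (hle ξ η)
  have heq : discrepancy ρ τ = fun ξ => Real.log (sSup (g ξ '' Set.univ)) := by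
    ext ξ
    apply le_antisymm
    · refine h.discrepancy_le fun η hη => ?_
      rw [← hlog ξ η hη]
      exact Real.log_le_log (hgpos ξ η hη) (hle ξ η)
    · rw [Real.log_le_iff_le_exp (hpos ξ)]
      refine csSup_le ⟨_, ξ, Set.mem_univ _, rfl⟩ ?_
      rintro _ ⟨η, -, rfl⟩
      by_cases hη : η = ξ
      · simp only [hg, (h.toIsSeparating.eq_zero_iff ξ η).2 hη.symm]
        simpa using (Real.exp_pos _).le
      · rw [← Real.log_le_iff_le_exp (hgpos ξ η hη), hlog ξ η hη]
        exact h.le_discrepancy τ hη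
  rw [heq]
  exact hsup.log fun ξ => (hpos ξ).ne'

theorem IsAntipodal.exists_antipodalFlowSol (h : IsAntipodal ρ) (τ₀ : C(Z, ℝ)) :
    ∃ τ : ℝ → C(Z, ℝ), τ 0 = τ₀ ∧ IsAntipodalFlowSol ρ τ := by
  let f : C(Z, ℝ) → C(Z, ℝ) := fun τ => -⟨discrepancy ρ τ, h.continuous_discrepancy τ⟩
  have hf : LipschitzWith 2 f := by
    refine LipschitzWith.of_dist_le_mul fun τ σ => ?_
    rw [ContinuousMap.dist_le (by positivity)]
    intro ξ
    have h1 := h.discrepancy_le_add τ σ ξ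
    have h2 := h.discrepancy_le_add σ τ ξ
    rw [norm_sub_rev] at h2
    simp only [f, ContinuousMap.neg_apply, ContinuousMap.coe_mk, dist_eq_norm,
      NNReal.coe_ofNat, Real.norm_eq_abs]
    rw [abs_le]
    constructor <;> linarith
  obtain ⟨τ, h0, hτ⟩ := hf.exists_isIntegralCurveOn_Ici τ₀
  exact ⟨τ, h0, fun t ht => ⟨f (τ t), fun _ => rfl, hτ t ht⟩⟩

end Discrepancy

section Flow

variable [TopologicalSpace Z] [CompactSpace Z] {ρ : Z → Z → ℝ} {τ : ℝ → C(Z, ℝ)}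

theorem IsAntipodalFlowSol.hasDerivWithinAt_apply (hτ : IsAntipodalFlowSol ρ τ) (ξ : Z) {t : ℝ}
    (ht : 0 ≤ t) :
    HasDerivWithinAt (fun s => τ s ξ) (-discrepancy ρ (τ t) ξ) (Set.Ici 0) t := by
  obtain ⟨τ', h1, h2⟩ := hτ t ht
  rw [← h1 ξ]
  exact (ContinuousMap.evalCLM ℝ ξ).hasFDerivAt.comp_hasDerivWithinAt t h2

theorem hasDerivAt_exp_const_mul (c t : ℝ) :
    HasDerivAt (fun s => Real.exp (c * s)) (Real.exp (c * t) * c) t := by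
  simpa using ((hasDerivAt_id t).const_mul c).exp

/-- Along the flow each of the functions whose supremum is the discrepancy decays exponentially. -/
theorem IsAntipodalFlowSol.pair_le (hτ : IsAntipodalFlowSol ρ τ) (h : IsAntipodal ρ) {ξ η : Z}
    (hne : η ≠ ξ) {t : ℝ} (ht : 0 ≤ t) :
    τ t ξ + τ t η + Real.log (ρ ξ η ^ 2) ≤ Real.exp (-2 * t) * discrepancy ρ (τ 0) ξ := by
  have hd : ∀ s ∈ Set.Ici (0 : ℝ), HasDerivWithinAt
      (fun s => Real.exp (2 * s) * (τ s ξ + τ s η + Real.log (ρ ξ η ^ 2)))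
      (Real.exp (2 * s) * 2 * (τ s ξ + τ s η + Real.log (ρ ξ η ^ 2)) +
        Real.exp (2 * s) * (-discrepancy ρ (τ s) ξ + -discrepancy ρ (τ s) η)) (Set.Ici 0) s :=
    fun s hs => (hasDerivAt_exp_const_mul 2 s).hasDerivWithinAt.mul
      (((hτ.hasDerivWithinAt_apply ξ hs).add (hτ.hasDerivWithinAt_apply η hs)).add_const _)
  have hanti := antitoneOn_of_hasDerivWithinAt_nonpos (convex_Ici 0)
    (fun s hs => (hd s hs).continuousWithinAt)
    (fun s hs => (hd s (interior_subset hs)).mono interior_subset) (fun s hs => by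
      have h1 := h.le_discrepancy (τ s) hne
      have h2 := h.le_discrepancy (τ s) hne.symm
      rw [h.toIsSeparating.symm η ξ] at h2
      have h3 := Real.exp_pos (2 * s)
      have : Real.exp (2 * s) * (2 * (τ s ξ + τ s η + Real.log (ρ ξ η ^ 2)) +
        (-discrepancy ρ (τ s) ξ + -discrepancy ρ (τ s) η)) ≤ 0 :=
        mul_nonpos_of_nonneg_of_nonpos h3.le (by linarith)
      linarith)
  have h1 := hanti Set.self_mem_Ici ht ht
  simp only [mul_zero, Real.exp_zero, one_mul] at h1
  have h2 := h1.trans (h.le_discrepancy (τ 0) hne)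
  have h3 := mul_le_mul_of_nonneg_left h2 (Real.exp_pos (-2 * t)).le
  rwa [← mul_assoc, ← Real.exp_add, show -2 * t + 2 * t = 0 by ring, Real.exp_zero, one_mul] at h3

theorem IsAntipodalFlowSol.discrepancy_le (hτ : IsAntipodalFlowSol ρ τ) (h : IsAntipodal ρ) (ξ : Z)
    {t : ℝ} (ht : 0 ≤ t) :
    discrepancy ρ (τ t) ξ ≤ Real.exp (-2 * t) * discrepancy ρ (τ 0) ξ :=
  h.discrepancy_le fun _ hη => hτ.pair_le h hη ht

theorem IsAntipodalFlowSol.monotoneOn (hτ : IsAntipodalFlowSol ρ τ) (h : IsAntipodal ρ) (ξ : Z) :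
    MonotoneOn (fun t => τ t ξ - Real.exp (-2 * t) * (discrepancy ρ (τ 0) ξ / 2)) (Set.Ici 0) := by
  have hd : ∀ s ∈ Set.Ici (0 : ℝ), HasDerivWithinAt
      (fun t => τ t ξ - Real.exp (-2 * t) * (discrepancy ρ (τ 0) ξ / 2))
      (-discrepancy ρ (τ s) ξ - Real.exp (-2 * s) * -2 * (discrepancy ρ (τ 0) ξ / 2))
      (Set.Ici 0) s := fun s hs => (hτ.hasDerivWithinAt_apply ξ hs).sub
        ((hasDerivAt_exp_const_mul (-2) s).hasDerivWithinAt.mul_const _)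
  exact monotoneOn_of_hasDerivWithinAt_nonneg (convex_Ici 0)
    (fun s hs => (hd s hs).continuousWithinAt)
    (fun s hs => (hd s (interior_subset hs)).mono interior_subset) (fun s hs => by
      linarith [hτ.discrepancy_le h ξ (interior_subset hs : s ∈ Set.Ici (0 : ℝ))])

theorem IsAntipodalFlowSol.sub_le (hτ : IsAntipodalFlowSol ρ τ) (h : IsAntipodal ρ) (ξ : Z)
    {s t : ℝ} (hs : 0 ≤ s) (hst : s ≤ t) :
    τ s ξ - τ t ξ ≤ Real.exp (-2 * s) * ‖τ 0‖ := by
  have h1 := hτ.monotoneOn h ξ hs (hs.trans hst) hst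
  have h2 := h.discrepancy_le_norm (τ 0) ξ
  have h3 : Real.exp (-2 * t) ≤ Real.exp (-2 * s) := Real.exp_le_exp.2 (by linarith)
  have h4 := Real.exp_pos (-2 * t)
  dsimp only at h1
  nlinarith [norm_nonneg (τ 0), mul_nonneg (sub_nonneg.2 h3) (sub_nonneg.2 h2),
    mul_nonneg h4.le (norm_nonneg (τ 0))]

theorem IsAntipodalFlowSol.sub_le_neg_discrepancy (hτ : IsAntipodalFlowSol ρ τ) (h : IsAntipodal ρ)
    (ξ : Z) {s t : ℝ} (hs : 0 ≤ s) (hst : s ≤ t) :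
    τ t ξ - τ s ξ ≤ -discrepancy ρ (τ s) ξ + 3 * ‖τ 0‖ * Real.exp (-2 * s) := by
  have h3 : Real.exp (-2 * t) ≤ Real.exp (-2 * s) := Real.exp_le_exp.2 (by linarith)
  have h4 := Real.exp_pos (-2 * t)
  have h5 : Real.exp (-2 * t) * discrepancy ρ (τ 0) ξ ≤ Real.exp (-2 * s) * (2 * ‖τ 0‖) := by
    refine (mul_le_mul_of_nonneg_left (h.discrepancy_le_norm (τ 0) ξ) h4.le).trans ?_
    gcongr
  have : discrepancy ρ (τ s) ξ ≤ τ s ξ - τ t ξ + 3 * ‖τ 0‖ * Real.exp (-2 * s) :=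
    h.discrepancy_le fun η hη => by
      linarith [hτ.pair_le h hη (hs.trans hst), hτ.sub_le h η hs hst]
  linarith

theorem IsAntipodalFlowSol.sub_le_exp (hτ : IsAntipodalFlowSol ρ τ) (h : IsAntipodal ρ)
    (ξ : Z) {s t : ℝ} (hs : 0 ≤ s) (hst : s ≤ t) :
    τ t ξ - τ s ξ ≤ 8 * ‖τ 0‖ * Real.exp (-1 * s) := by
  have hd : ∀ r ∈ Set.Icc 0 t, HasDerivWithinAt
      (fun r => Real.exp (1 * r) * (τ t ξ - τ r ξ) + 3 * ‖τ 0‖ * Real.exp (-1 * r))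
      (Real.exp (1 * r) * 1 * (τ t ξ - τ r ξ) + Real.exp (1 * r) * -(-discrepancy ρ (τ r) ξ) +
        3 * ‖τ 0‖ * (Real.exp (-1 * r) * -1))
      (Set.Icc 0 t) r := fun r hr =>
        ((hasDerivAt_exp_const_mul 1 r).hasDerivWithinAt.mul
          (((hτ.hasDerivWithinAt_apply ξ hr.1).mono Set.Icc_subset_Ici_self).const_sub _)).add
        ((hasDerivAt_exp_const_mul (-1) r).hasDerivWithinAt.const_mul _)
  have hanti := antitoneOn_of_hasDerivWithinAt_nonpos (convex_Icc 0 t)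
    (fun r hr => (hd r hr).continuousWithinAt)
    (fun r hr => (hd r (interior_subset hr)).mono interior_subset) (fun r hr => by
      have hr' : r ∈ Set.Icc 0 t := interior_subset hr
      have h1 := mul_le_mul_of_nonneg_left (hτ.sub_le_neg_discrepancy h ξ hr'.1 hr'.2)
        (Real.exp_pos (1 * r)).le
      have h2 : Real.exp (1 * r) * Real.exp (-2 * r) = Real.exp (-1 * r) := by
        rw [← Real.exp_add]
        ring_nf
      linear_combination h1 + 3 * ‖τ 0‖ * h2)
  have h1 := hanti ⟨le_rfl, hs.trans hst⟩ ⟨hs, hst⟩ hs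
  simp only [mul_zero, Real.exp_zero, one_mul, mul_one] at h1
  have h2 := hτ.sub_le_neg_discrepancy h ξ le_rfl (hs.trans hst)
  simp only [mul_zero, Real.exp_zero, mul_one] at h2
  have h3 := h.neg_norm_le_discrepancy (τ 0) ξ
  have h4 : 0 ≤ 3 * ‖τ 0‖ * Real.exp (-1 * s) := by positivity
  have h5 : Real.exp s * (τ t ξ - τ s ξ) ≤ 8 * ‖τ 0‖ := by linarith
  have h6 := mul_le_mul_of_nonneg_left h5 (Real.exp_pos (-1 * s)).le
  rw [← mul_assoc, ← Real.exp_add, show -1 * s + s = 0 by ring, Real.exp_zero, one_mul] at h6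
  linarith

theorem IsAntipodalFlowSol.exists_tendsto (hτ : IsAntipodalFlowSol ρ τ) (h : IsAntipodal ρ) :
    ∃ σ, Tendsto τ atTop (𝓝 σ) := by
  have hdist : ∀ s t : ℝ, 0 ≤ s → s ≤ t → dist (τ s) (τ t) ≤ 8 * ‖τ 0‖ * Real.exp (-1 * s) := by
    intro s t hs hst
    rw [ContinuousMap.dist_le (by positivity)]
    intro ξ
    have h1 := hτ.sub_le_exp h ξ hs hst
    have h2 := hτ.sub_le h ξ hs hst
    have h3 : Real.exp (-2 * s) * ‖τ 0‖ ≤ Real.exp (-1 * s) * ‖τ 0‖ := by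
      gcongr
      linarith
    have h4 : 0 ≤ Real.exp (-1 * s) * ‖τ 0‖ := by positivity
    rw [Real.dist_eq, abs_le]
    constructor <;> linarith
  have hlim : Tendsto (fun s : ℝ => 8 * ‖τ 0‖ * Real.exp (-1 * max s 0)) atTop (𝓝 0) := by
    have h1 : Tendsto (fun s : ℝ => Real.exp (-1 * max s 0)) atTop (𝓝 0) :=
      Real.tendsto_exp_atBot.comp ((tendsto_atTop_mono (fun s => le_max_left s 0)
        tendsto_id).const_mul_atTop_of_neg (by norm_num))
    simpa using h1.const_mul (8 * ‖τ 0‖)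
  have hcauchy : CauchySeq fun s : ℝ => τ (max s 0) :=
    cauchySeq_of_le_tendsto_0' _
      (fun s t hst => hdist _ _ (le_max_right _ _) (max_le_max_right 0 hst)) hlim
  obtain ⟨σ, hσ⟩ := cauchySeq_tendsto_of_complete hcauchy
  refine ⟨σ, hσ.congr' ?_⟩
  filter_upwards [eventually_ge_atTop 0] with s hs
  rw [max_eq_left hs]

theorem tendsto_exp_neg_two_mul_atTop : Tendsto (fun t : ℝ => Real.exp (-2 * t)) atTop (𝓝 0) :=
  Real.tendsto_exp_atBot.comp (tendsto_id.const_mul_atTop_of_neg (by norm_num))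

theorem IsAntipodalFlowSol.le_limit (hτ : IsAntipodalFlowSol ρ τ) (h : IsAntipodal ρ)
    {σ : C(Z, ℝ)} (hσ : Tendsto τ atTop (𝓝 σ)) (ξ : Z) :
    τ 0 ξ - 1 / 2 * discrepancy ρ (τ 0) ξ ≤ σ ξ := by
  have hσξ : Tendsto (fun t => τ t ξ) atTop (𝓝 (σ ξ)) :=
    ((continuous_eval_const ξ).tendsto σ).comp hσ
  have hlim := hσξ.sub (tendsto_exp_neg_two_mul_atTop.mul_const (discrepancy ρ (τ 0) ξ / 2))
  rw [zero_mul, sub_zero] at hlim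
  refine ge_of_tendsto hlim ?_
  filter_upwards [eventually_ge_atTop 0] with t ht
  have := hτ.monotoneOn h ξ Set.self_mem_Ici ht ht
  simp only [mul_zero, Real.exp_zero, one_mul] at this
  linarith

theorem IsAntipodalFlowSol.limit_pair_nonpos (hτ : IsAntipodalFlowSol ρ τ) (h : IsAntipodal ρ)
    {σ : C(Z, ℝ)} (hσ : Tendsto τ atTop (𝓝 σ)) {ξ η : Z} (hne : η ≠ ξ) :
    σ ξ + σ η + Real.log (ρ ξ η ^ 2) ≤ 0 := by
  have hσξ : ∀ ζ, Tendsto (fun t => τ t ζ) atTop (𝓝 (σ ζ)) := fun ζ =>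
    ((continuous_eval_const ζ).tendsto σ).comp hσ
  have hlim := tendsto_exp_neg_two_mul_atTop.mul_const (discrepancy ρ (τ 0) ξ)
  rw [zero_mul] at hlim
  refine le_of_tendsto_of_tendsto (((hσξ ξ).add (hσξ η)).add_const _) hlim ?_
  filter_upwards [eventually_ge_atTop 0] with t ht
  exact hτ.pair_le h hne ht

end Flow

theorem IsAntipodal.antipodalization_eq [TopologicalSpace Z] [CompactSpace Z] {ρ : Z → Z → ℝ}
    (h : IsAntipodal ρ) (τ₀ : C(Z, ℝ)) :
    ∃ (τ : ℝ → C(Z, ℝ)) (σ : C(Z, ℝ)), τ 0 = τ₀ ∧ IsAntipodalFlowSol ρ τ ∧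
      Tendsto τ atTop (𝓝 σ) ∧ antipodalization ρ τ₀ = eMap ρ σ := by
  have hex : ∃ p : (ℝ → C(Z, ℝ)) × C(Z, ℝ), p.1 0 = τ₀ ∧ IsAntipodalFlowSol ρ p.1 ∧
      Filter.Tendsto p.1 Filter.atTop (𝓝 p.2) := by
    obtain ⟨τ, h0, hτ⟩ := h.exists_antipodalFlowSol τ₀
    obtain ⟨σ, hσ⟩ := hτ.exists_tendsto h
    exact ⟨(τ, σ), h0, hτ, hσ⟩
  obtain ⟨h0, hτ, hσ⟩ := hex.choose_spec
  exact ⟨hex.choose.1, hex.choose.2, h0, hτ, hσ, dif_pos hex⟩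

theorem statement11 [TopologicalSpace Z] [CompactSpace Z]
    [TopologicalSpace.MetrizableSpace Z] (h4 : HasFourPoints Z)
    (ρ₀ : Z → Z → ℝ) (h₀ : IsAntipodal ρ₀)
    (ρ₁ : Z → Z → ℝ) (hρ₁ : ρ₁ ∈ MoebiusSpace ρ₀) (τ₀ : C(Z, ℝ)) :
    ∀ ξ : Z,
      τ₀ ξ - (1 / 2) * discrepancy ρ₁ τ₀ ξ ≤
        Real.log (mDeriv ρ₁ (antipodalization ρ₁ τ₀) ξ) ∧
      ∀ η : Z, (∀ ζ, eMap ρ₁ τ₀ ξ ζ ≤ eMap ρ₁ τ₀ ξ η) →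
        Real.log (mDeriv ρ₁ (antipodalization ρ₁ τ₀) ξ) ≤
          τ₀ ξ - discrepancy ρ₁ τ₀ ξ + (1 / 2) * discrepancy ρ₁ τ₀ η := by
  obtain ⟨h, -⟩ := hρ₁
  obtain ⟨τ, σ, rfl, hτ, hσ, heq⟩ := h.antipodalization_eq τ₀
  intro ξ
  rw [heq, h4.log_mDeriv_eMap h.toIsSeparating]
  refine ⟨hτ.le_limit h hσ ξ, fun η hη => ?_⟩
  obtain ⟨hne, hle⟩ := h.discrepancy_le_of_forall_eMap_le (τ 0) hη
  linarith [hτ.le_limit h hσ η, hτ.limit_pair_nonpos h hσ hne]
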